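/- arXiv:2205.04009 — 2 statements merged into one kernel-verified Lean document; each statement's English description precedes it below -/
import Mathlib

section
/- Let Σ = η_enc² I_{d1} (i.e. σ_i = η_enc for all i). Define, for 1 ≤ i ≤ d1, λ_i = sqrt(max(0, (√β η_dec/η_enc²) · (ζ_i − √β η_dec))) and θ_i = sqrt(max(0, (η_enc²/(√β η_dec)) · (ζ_i − √β η_dec))), and let Λ ∈ ℝ^{d2×d1}, Θ ∈ ℝ^{d0×d1} be the rectangular diagonal matrices with these diagonal entries. Then for every orthogonal P ∈ ℝ^{d1×d1}, the pair U* = F Λ P, V* = G Θ P is a global minimizer of L over all (U,V). Consequently, U* = 0 and V* = 0 is a global minimizer (complete posterior collapse) if and only if ζ_1 ≤ √β η_dec. -/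
open Matrix BigOperators

noncomputable def frobSq {m n : ℕ} (M : Matrix (Fin m) (Fin n) ℝ) : ℝ :=
  ∑ i, ∑ j, (M i j) ^ 2

lemma frobSq_eq_trace {m n : ℕ} (M : Matrix (Fin m) (Fin n) ℝ) :
    frobSq M = Matrix.trace (M * Mᵀ) := by
  simp [frobSq, Matrix.trace, Matrix.mul_apply, pow_two]

lemma frobSq_mul_left {m n : ℕ} (Q : Matrix (Fin m) (Fin m) ℝ) (hQ : Qᵀ * Q = 1)
    (M : Matrix (Fin m) (Fin n) ℝ) : frobSq (Q * M) = frobSq M := by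
  rw [frobSq_eq_trace, frobSq_eq_trace, Matrix.transpose_mul, Matrix.mul_assoc,
    Matrix.trace_mul_comm, Matrix.mul_assoc, Matrix.mul_assoc, hQ, Matrix.mul_one]

lemma frobSq_mul_right {m n : ℕ} (Q : Matrix (Fin n) (Fin n) ℝ) (hQ : Q * Qᵀ = 1)
    (M : Matrix (Fin m) (Fin n) ℝ) : frobSq (M * Q) = frobSq M := by
  rw [frobSq_eq_trace, frobSq_eq_trace, Matrix.transpose_mul, Matrix.mul_assoc,
    ← Matrix.mul_assoc Q, hQ, Matrix.one_mul]

lemma trace_diag_eq {m n : ℕ} (U : Matrix (Fin m) (Fin n) ℝ) (c : ℝ) :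
    Matrix.trace (U * Matrix.diagonal (fun _ : Fin n => c) * Uᵀ) = c * frobSq U := by
  simp only [frobSq, Matrix.trace, Matrix.diag_apply, Finset.mul_sum]
  refine Finset.sum_congr rfl fun i _ => ?_
  rw [Matrix.mul_apply]
  refine Finset.sum_congr rfl fun j _ => ?_
  rw [Matrix.mul_diagonal, Matrix.transpose_apply]
  ring

/-- extend a range sum by zeros -/
lemma sum_range_ext (a N : ℕ) (h : a ≤ N) (g g' : ℕ → ℝ) (h1 : ∀ i, i < a → g i = g' i)
    (h2 : ∀ i, a ≤ i → g' i = 0) : ∑ i ∈ Finset.range a, g i = ∑ i ∈ Finset.range N, g' i := by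
  rw [← Finset.sum_subset (Finset.range_mono h)]
  · exact Finset.sum_congr rfl fun i hi => h1 i (Finset.mem_range.1 hi)
  · intro i _ hi
    exact h2 i (by simpa using hi)

/-- sum over a rectangular diagonal -/
lemma sum_rdiag (m n N : ℕ) (hN : m ≤ N) (g g' : ℕ → ℝ)
    (h1 : ∀ i, i < m → i < n → g i = g' i) (h2 : ∀ i, m ≤ i → g' i = 0)
    (h3 : ∀ i, n ≤ i → g' i = 0) :
    ∑ i : Fin m, ∑ j : Fin n, (if (i : ℕ) = (j : ℕ) then g i else 0)
      = ∑ i ∈ Finset.range N, g' i := by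
  rw [← sum_range_ext m N hN g' g' (fun _ _ => rfl) h2, ← Fin.sum_univ_eq_sum_range]
  refine Finset.sum_congr rfl fun i _ => ?_
  by_cases hi : (i : ℕ) < n
  · rw [Finset.sum_eq_single (⟨i, hi⟩ : Fin n)]
    · simp [h1 i i.2 hi]
    · intro b _ hb
      rw [if_neg]
      intro h
      exact hb (Fin.ext h.symm)
    · simp
  · rw [h3 i (by omega)]
    refine Finset.sum_eq_zero fun j _ => ?_
    rw [if_neg]
    have := j.2
    omega

lemma majorization (k N : ℕ) (hk : k ≤ N) (w q : ℕ → ℝ) (hw : ∀ i j, i ≤ j → w j ≤ w i)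
    (hw0 : ∀ i, 0 ≤ w i) (hq0 : ∀ i, 0 ≤ q i) (hq1 : ∀ i, q i ≤ 1)
    (hs : ∑ i ∈ Finset.range N, q i ≤ k) :
    ∑ i ∈ Finset.range N, w i * q i ≤ ∑ i ∈ Finset.range k, w i := by
  rw [sum_range_ext k N hk w (fun i => if i < k then w i else 0)
    (fun i hi => by simp [hi]) (fun i hi => by simp [hi])]
  have h1 : ∑ i ∈ Finset.range k, (1:ℝ) = ∑ i ∈ Finset.range N, (if i < k then (1:ℝ) else 0) :=
    sum_range_ext k N hk _ _ (fun i hi => by simp [hi]) (fun i hi => by simp [hi])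
  simp only [Finset.sum_const, Finset.card_range, nsmul_eq_mul, mul_one] at h1
  have h2 : ∑ i ∈ Finset.range N, (w i * q i - (if i < k then w i else 0))
      ≤ ∑ i ∈ Finset.range N, w k * (q i - (if i < k then (1:ℝ) else 0)) := by
    refine Finset.sum_le_sum fun i _ => ?_
    split_ifs with h
    · nlinarith [hw i k h.le, hq1 i]
    · nlinarith [hw k i (by omega), hq0 i]
  rw [← Finset.mul_sum, Finset.sum_sub_distrib, Finset.sum_sub_distrib, ← h1] at h2
  nlinarith [hw0 k]

/-- squared lengths of the projections of the standard basis on the column space. -/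
lemma exists_q {n k : ℕ} (A : Matrix (Fin n) (Fin k) ℝ) :
    ∃ q : Fin n → ℝ, (∀ i, 0 ≤ q i) ∧ (∀ i, q i ≤ 1) ∧ ∑ i, q i ≤ k ∧
      ∀ (x : Fin k → ℝ) (j : Fin n) (t : ℝ),
        t ^ 2 * (1 - q j) ≤ ∑ i, ((A *ᵥ x) i - if i = j then t else 0) ^ 2 := by
  classical
  let col : Fin k → EuclideanSpace ℝ (Fin n) := fun l => WithLp.toLp 2 (fun i => A i l)
  let W : Submodule ℝ (EuclideanSpace ℝ (Fin n)) := Submodule.span ℝ (Set.range col)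
  let e : Fin n → EuclideanSpace ℝ (Fin n) := fun j => EuclideanSpace.single j (1:ℝ)
  let b := stdOrthonormalBasis ℝ W
  have hrank : Module.finrank ℝ W ≤ k := by
    have h := finrank_range_le_card (R := ℝ) col
    rw [Fintype.card_fin] at h
    exact h
  have hon : Orthonormal ℝ (fun l => (b l : EuclideanSpace ℝ (Fin n))) := by
    have := b.orthonormal
    exact this.comp_linearIsometry W.subtypeₗᵢ
  have key : ∀ y : EuclideanSpace ℝ (Fin n), ‖W.starProjection y‖ ^ 2 = ∑ l, (inner ℝ (b l : EuclideanSpace ℝ (Fin n)) y) ^ 2 := by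
    intro y
    have h := b.sum_sq_norm_inner_right (W.orthogonalProjectionOnto y)
    rw [Submodule.starProjection_apply, ← Submodule.coe_norm, ← h]
    refine Finset.sum_congr rfl fun l _ => ?_
    rw [Submodule.inner_orthogonalProjectionOnto_eq_of_mem_left, Real.norm_eq_abs, sq_abs]
  refine ⟨fun j => ‖W.starProjection (e j)‖ ^ 2, fun i => by positivity, ?_, ?_, ?_⟩
  · intro j
    have h : ‖W.starProjection (e j)‖ ≤ ‖e j‖ := W.norm_starProjection_apply_le (e j)
    have h1 : ‖e j‖ = 1 := by simp [e]
    rw [h1] at h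
    have := norm_nonneg (W.starProjection (e j))
    nlinarith
  · simp only [key]
    rw [Finset.sum_comm]
    have : ∀ l, ∑ j, (inner ℝ (b l : EuclideanSpace ℝ (Fin n)) (e j)) ^ 2 = 1 := by
      intro l
      have h1 : ‖(b l : EuclideanSpace ℝ (Fin n))‖ = 1 := hon.1 l
      have h2 := EuclideanSpace.norm_sq_eq (b l : EuclideanSpace ℝ (Fin n))
      rw [h1] at h2
      simp only [e, EuclideanSpace.inner_single_right]
      simp at h2 ⊢
      exact h2.symm
    simp only [this]
    simpa using hrank
  · intro x j t
    let c : EuclideanSpace ℝ (Fin n) := WithLp.toLp 2 (A *ᵥ x)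
    have hc : c ∈ W := by
      have : c = ∑ l, x l • col l := by
        ext i
        simp [c, col, Matrix.mulVec, dotProduct, mul_comm]
      rw [this]
      exact Submodule.sum_mem _ fun l _ => Submodule.smul_mem _ _
        (Submodule.subset_span ⟨l, rfl⟩)
    have h1 : ∑ i, ((A *ᵥ x) i - if i = j then t else 0) ^ 2 = ‖c - t • e j‖ ^ 2 := by
      rw [EuclideanSpace.norm_sq_eq]
      refine Finset.sum_congr rfl fun i _ => ?_
      rw [Real.norm_eq_abs, sq_abs]
      simp [c, e, Pi.single_apply]
    rw [h1]
    set y := t • e j with hy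
    have hy1 : ‖y‖ ^ 2 = t ^ 2 := by
      rw [hy, norm_smul, mul_pow]; simp [e]
    have hy2 : ‖W.starProjection y‖ ^ 2 = t ^ 2 * ‖W.starProjection (e j)‖ ^ 2 := by
      rw [hy, map_smul, norm_smul, mul_pow]; simp
    have hy3 := Submodule.norm_sq_eq_add_norm_sq_starProjection y W
    have hy4 : Wᗮ.starProjection (c - y) = - Wᗮ.starProjection y := by
      rw [map_sub, Submodule.starProjection_orthogonal_apply_eq_zero hc, zero_sub]
    have hy5 := Wᗮ.norm_starProjection_apply_le (c - y)
    rw [hy4, norm_neg] at hy5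
    have := norm_nonneg (Wᗮ.starProjection y)
    nlinarith

/-- Eckart-Young for a rectangular diagonal matrix. -/
lemma eckart_young {d0 d1 d2 N : ℕ} (hN : d0 + d1 + d2 ≤ N) (μ : ℕ → ℝ)
    (hmono : ∀ i j, i ≤ j → μ j ≤ μ i) (h0 : ∀ i, 0 ≤ μ i) (hz : ∀ i, min d0 d2 ≤ i → μ i = 0)
    (A : Matrix (Fin d2) (Fin d1) ℝ) (B : Matrix (Fin d0) (Fin d1) ℝ) :
    ∑ i ∈ Finset.range N, μ i ^ 2 - ∑ i ∈ Finset.range d1, μ i ^ 2 ≤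
      frobSq (A * Bᵀ - Matrix.of fun (i : Fin d2) (j : Fin d0) =>
        if (i : ℕ) = (j : ℕ) then μ i else 0) := by
  obtain ⟨q, hq0, hq1, hqs, hq⟩ := exists_q A
  let Q : ℕ → ℝ := fun i => if h : i < d2 then q ⟨i, h⟩ else 0
  have hQ0 : ∀ i, 0 ≤ Q i := fun i => by dsimp [Q]; split_ifs; exacts [hq0 _, le_rfl]
  have hQ1 : ∀ i, Q i ≤ 1 := fun i => by dsimp [Q]; split_ifs; exacts [hq1 _, zero_le_one]
  have hQs : ∑ i ∈ Finset.range N, Q i ≤ d1 := by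
    rw [← sum_range_ext d2 N (by omega) Q Q (fun _ _ => rfl)
      (fun i hi => by simp [Q, hi]), ← Fin.sum_univ_eq_sum_range]
    simpa [Q] using hqs
  have hmaj := majorization d1 N (by omega) (fun i => μ i ^ 2) Q
    (fun i j h => pow_le_pow_left₀ (h0 j) (hmono i j h) 2) (fun i => by positivity) hQ0 hQ1 hQs
  have hsum : ∑ j : Fin d0, μ j ^ 2 * (1 - Q j) = ∑ i ∈ Finset.range N, μ i ^ 2 * (1 - Q i) := by
    rw [Fin.sum_univ_eq_sum_range (fun i => μ i ^ 2 * (1 - Q i))]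
    exact sum_range_ext d0 N (by omega) _ _ (fun _ _ => rfl)
      (fun i hi => by rw [hz i (le_trans (min_le_left _ _) hi)]; ring)
  have hle : ∑ j : Fin d0, μ j ^ 2 * (1 - Q j) ≤
      frobSq (A * Bᵀ - Matrix.of fun (i : Fin d2) (j : Fin d0) =>
        if (i : ℕ) = (j : ℕ) then μ i else 0) := by
    rw [frobSq, Finset.sum_comm]
    refine Finset.sum_le_sum fun j _ => ?_
    by_cases hj : (j : ℕ) < d2
    · have h := hq (B j) ⟨j, hj⟩ (μ j)
      have hQj : Q j = q ⟨j, hj⟩ := by simp [Q, hj]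
      rw [hQj]
      refine h.trans (le_of_eq (Finset.sum_congr rfl fun i _ => ?_))
      congr 1
      rw [Matrix.sub_apply, Matrix.of_apply]
      congr 1
      by_cases hij : (i : ℕ) = j
      · rw [if_pos hij, if_pos (Fin.ext hij), hij]
      · rw [if_neg hij, if_neg (fun h => hij (by rw [h]))]
    · rw [hz j (le_trans (min_le_right _ _) (by omega))]
      simp only [ne_eq, OfNat.ofNat_ne_zero, not_false_eq_true, zero_pow, zero_mul]
      positivity
  have : ∑ i ∈ Finset.range N, μ i ^ 2 * (1 - Q i)
      = ∑ i ∈ Finset.range N, μ i ^ 2 - ∑ i ∈ Finset.range N, μ i ^ 2 * Q i := by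
    rw [← Finset.sum_sub_distrib]
    exact Finset.sum_congr rfl fun i _ => by ring
  linarith

lemma elem_bound {e s z a b : ℝ} (he : 0 < e) (hs : 0 < s) (hz : 0 ≤ z) :
    2 * (z - max 0 (z - s)) * (a * b) ≤ e ^ 2 * a ^ 2 + s ^ 2 / e ^ 2 * b ^ 2 := by
  have h1 : 2 * s * |a * b| ≤ e ^ 2 * a ^ 2 + s ^ 2 / e ^ 2 * b ^ 2 := by
    have h2 : e ^ 2 * a ^ 2 + s ^ 2 / e ^ 2 * b ^ 2 = (e * |a|) ^ 2 + (s / e * |b|) ^ 2 := by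
      rw [mul_pow, mul_pow, sq_abs, sq_abs, div_pow]
    have h3 : 2 * s * |a * b| = 2 * (e * |a|) * (s / e * |b|) := by
      rw [abs_mul]; field_simp
    rw [h2, h3]
    exact two_mul_le_add_sq _ _
  have hab := le_abs_self (a * b)
  have habs := abs_nonneg (a * b)
  rcases max_cases 0 (z - s) with ⟨h, h'⟩ | ⟨h, h'⟩ <;> rw [h] <;> nlinarith

/-- diagonal cross term -/
lemma cross_bound {d0 d1 d2 : ℕ} {e s : ℝ} (he : 0 < e) (hs : 0 < s) (ζ : ℕ → ℝ)
    (hζ : ∀ i, 0 ≤ ζ i)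
    (A : Matrix (Fin d2) (Fin d1) ℝ) (B : Matrix (Fin d0) (Fin d1) ℝ) :
    ∑ i : Fin d2, ∑ j : Fin d0, (if (i : ℕ) = (j : ℕ) then
      2 * (ζ i - max 0 (ζ i - s)) * (A * Bᵀ) i j else 0)
      ≤ e ^ 2 * frobSq A + s ^ 2 / e ^ 2 * frobSq B := by
  have h1 : ∀ (i : Fin d2) (j : Fin d0), (if (i : ℕ) = (j : ℕ) then
      2 * (ζ i - max 0 (ζ i - s)) * (A * Bᵀ) i j else 0) ≤
      (if (i : ℕ) = (j : ℕ) then e ^ 2 * ∑ l, A i l ^ 2 else 0) +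
      (if (i : ℕ) = (j : ℕ) then s ^ 2 / e ^ 2 * ∑ l, B j l ^ 2 else 0) := by
    intro i j
    split_ifs
    · rw [Matrix.mul_apply, Finset.mul_sum, Finset.mul_sum, Finset.mul_sum,
        ← Finset.sum_add_distrib]
      exact Finset.sum_le_sum fun l _ => elem_bound he hs (hζ i)
    · simp
  have h2 : ∀ (m n : ℕ) (g : Fin m → ℝ), (∀ i, 0 ≤ g i) →
      ∑ i : Fin m, ∑ j : Fin n, (if (i : ℕ) = (j : ℕ) then g i else 0) ≤ ∑ i, g i := by
    intro m n g hg
    refine Finset.sum_le_sum fun i _ => ?_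
    by_cases hi : (i : ℕ) < n
    · rw [Finset.sum_eq_single (⟨i, hi⟩ : Fin n)]
      · simp
      · intro b _ hb
        rw [if_neg]
        intro h
        exact hb (Fin.ext h.symm)
      · simp
    · rw [Finset.sum_eq_zero]
      · exact hg i
      · intro j _
        rw [if_neg]
        have := j.2
        omega
  have hA := h2 d2 d0 (fun i => e ^ 2 * ∑ l, A i l ^ 2) (fun i => by positivity)
  have hB := h2 d0 d2 (fun i => s ^ 2 / e ^ 2 * ∑ l, B i l ^ 2) (fun i => by positivity)
  rw [Finset.sum_comm] at hB
  simp only [eq_comm] at hB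
  calc _ ≤ _ := Finset.sum_le_sum fun i _ => Finset.sum_le_sum fun j _ => h1 i j
    _ = (∑ i : Fin d2, ∑ j : Fin d0, (if (i : ℕ) = (j : ℕ) then e ^ 2 * ∑ l, A i l ^ 2 else 0)) +
        ∑ i : Fin d2, ∑ j : Fin d0,
          (if (i : ℕ) = (j : ℕ) then s ^ 2 / e ^ 2 * ∑ l, B j l ^ 2 else 0) := by
      simp only [Finset.sum_add_distrib]
    _ ≤ _ := add_le_add hA hB
    _ = _ := by simp only [frobSq, Finset.mul_sum]

/-- The lower bound for the rotated problem. -/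
lemma lower_bound {d0 d1 d2 N : ℕ} (hN : d0 + d1 + d2 ≤ N) {e s : ℝ} (he : 0 < e) (hs : 0 < s)
    (ζ : ℕ → ℝ) (hmono : ∀ i j, i ≤ j → ζ j ≤ ζ i) (hζ : ∀ i, 0 ≤ ζ i)
    (hz : ∀ i, min d0 d2 ≤ i → ζ i = 0)
    (A : Matrix (Fin d2) (Fin d1) ℝ) (B : Matrix (Fin d0) (Fin d1) ℝ) :
    ∑ i ∈ Finset.range N, ζ i ^ 2 - ∑ i ∈ Finset.range d1, (max 0 (ζ i - s)) ^ 2 ≤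
      frobSq (A * Bᵀ - Matrix.of fun (i : Fin d2) (j : Fin d0) =>
        if (i : ℕ) = (j : ℕ) then ζ i else 0)
      + e ^ 2 * frobSq A + s ^ 2 / e ^ 2 * frobSq B := by
  have hμz : ∀ i, min d0 d2 ≤ i → max 0 (ζ i - s) = 0 := fun i hi => by
    rw [hz i hi]; exact max_eq_left (by linarith)
  have hEY := eckart_young hN (fun i => max 0 (ζ i - s))
    (fun i j h => max_le_max le_rfl (by linarith [hmono i j h])) (fun i => le_max_left _ _) hμz A B
  have hcr := cross_bound he hs ζ hζ A B
  have hD := sum_rdiag d2 d0 N (by omega) (fun i => ζ i ^ 2 - (max 0 (ζ i - s)) ^ 2)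
    (fun i => ζ i ^ 2 - (max 0 (ζ i - s)) ^ 2) (fun _ _ _ => rfl)
    (fun i hi => by
      rw [hμz i (le_trans (min_le_right _ _) hi), hz i (le_trans (min_le_right _ _) hi)]; ring)
    (fun i hi => by
      rw [hμz i (le_trans (min_le_left _ _) hi), hz i (le_trans (min_le_left _ _) hi)]; ring)
  rw [Finset.sum_sub_distrib] at hD
  have hid : frobSq (A * Bᵀ - Matrix.of fun (i : Fin d2) (j : Fin d0) =>
        if (i : ℕ) = (j : ℕ) then ζ i else 0) +
      ∑ i : Fin d2, ∑ j : Fin d0, (if (i : ℕ) = (j : ℕ) then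
      2 * (ζ i - max 0 (ζ i - s)) * (A * Bᵀ) i j else 0) =
      frobSq (A * Bᵀ - Matrix.of fun (i : Fin d2) (j : Fin d0) =>
        if (i : ℕ) = (j : ℕ) then max 0 (ζ i - s) else 0) +
      ∑ i : Fin d2, ∑ j : Fin d0, (if (i : ℕ) = (j : ℕ) then
      ζ i ^ 2 - (max 0 (ζ i - s)) ^ 2 else 0) := by
    simp only [frobSq, ← Finset.sum_add_distrib]
    refine Finset.sum_congr rfl fun i _ => Finset.sum_congr rfl fun j _ => ?_
    rw [Matrix.sub_apply, Matrix.sub_apply, Matrix.of_apply, Matrix.of_apply]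
    split_ifs <;> ring
  linarith

/-- The value at the candidate, for the rotated problem. -/
lemma value_at {d0 d1 d2 N : ℕ} (hN : d0 + d1 + d2 ≤ N) {e s : ℝ} (he : 0 < e) (hs : 0 < s)
    (ζ : ℕ → ℝ) (hz : ∀ i, min d0 d2 ≤ i → ζ i = 0) (lam θ : Fin d1 → ℝ)
    (hlam : ∀ i, lam i = Real.sqrt (max 0 ((s / e ^ 2) * (ζ i - s))))
    (hθ : ∀ i, θ i = Real.sqrt (max 0 ((e ^ 2 / s) * (ζ i - s)))) :
    frobSq ((Matrix.of fun (i : Fin d2) (j : Fin d1) => if (i : ℕ) = (j : ℕ) then lam j else 0) *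
      (Matrix.of fun (i : Fin d0) (j : Fin d1) => if (i : ℕ) = (j : ℕ) then θ j else 0)ᵀ -
      Matrix.of fun (i : Fin d2) (j : Fin d0) => if (i : ℕ) = (j : ℕ) then ζ i else 0)
      + e ^ 2 * frobSq (Matrix.of fun (i : Fin d2) (j : Fin d1) =>
          if (i : ℕ) = (j : ℕ) then lam j else 0)
      + s ^ 2 / e ^ 2 * frobSq (Matrix.of fun (i : Fin d0) (j : Fin d1) =>
          if (i : ℕ) = (j : ℕ) then θ j else 0)
    = ∑ i ∈ Finset.range N, ζ i ^ 2 - ∑ i ∈ Finset.range d1, (max 0 (ζ i - s)) ^ 2 := by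
  have hμz : ∀ i, min d0 d2 ≤ i → max 0 (ζ i - s) = 0 := fun i hi => by
    rw [hz i hi]; exact max_eq_left (by linarith)
  have hfac : ∀ c x : ℝ, 0 < c → max 0 (c * x) = c * max 0 x := fun c x hc => by
    rw [mul_max_of_nonneg _ _ hc.le, mul_zero]
  have hl : ∀ i, lam i = Real.sqrt (s / e ^ 2 * max 0 (ζ i - s)) := fun i => by
    rw [hlam, hfac _ _ (by positivity)]
  have ht : ∀ i, θ i = Real.sqrt (e ^ 2 / s * max 0 (ζ i - s)) := fun i => by
    rw [hθ, hfac _ _ (by positivity)]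
  have hm0 : ∀ i, 0 ≤ max 0 (ζ i - s) := fun i => le_max_left _ _
  have hl2 : ∀ i, e ^ 2 * lam i ^ 2 = s * max 0 (ζ i - s) := fun i => by
    rw [hl, Real.sq_sqrt (mul_nonneg (by positivity) (hm0 _))]; field_simp
  have ht2 : ∀ i, s ^ 2 / e ^ 2 * θ i ^ 2 = s * max 0 (ζ i - s) := fun i => by
    rw [ht, Real.sq_sqrt (mul_nonneg (by positivity) (hm0 _))]; field_simp
  have hlt : ∀ i, lam i * θ i = max 0 (ζ i - s) := fun i => by
    rw [hl, ht, ← Real.sqrt_mul (mul_nonneg (by positivity) (hm0 _))]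
    have : s / e ^ 2 * max 0 (ζ i - s) * (e ^ 2 / s * max 0 (ζ i - s))
      = (max 0 (ζ i - s)) ^ 2 := by field_simp
    rw [this, Real.sqrt_sq (hm0 _)]
  let ν : ℕ → ℝ := fun i => if i < d1 then max 0 (ζ i - s) else 0
  have hνz : ∀ i, min d0 d2 ≤ i → ν i = 0 := fun i hi => by simp only [ν, hμz i hi, ite_self]
  have hνz1 : ∀ i, d1 ≤ i → ν i = 0 := fun i hi => if_neg (by omega)
  have hA : e ^ 2 * frobSq (Matrix.of fun (i : Fin d2) (j : Fin d1) =>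
      if (i : ℕ) = (j : ℕ) then lam j else 0) = ∑ i ∈ Finset.range N, s * ν i := by
    rw [← sum_rdiag d2 d1 N (by omega) (fun i => s * max 0 (ζ i - s)) (fun i => s * ν i)
      (fun i _ hi => by simp only [ν, if_pos hi])
      (fun i hi => by rw [hνz i (le_trans (min_le_right _ _) hi), mul_zero])
      (fun i hi => by rw [hνz1 i hi, mul_zero])]
    simp only [frobSq, Finset.mul_sum, Matrix.of_apply]
    refine Finset.sum_congr rfl fun i _ => Finset.sum_congr rfl fun j _ => ?_
    split_ifs with h
    · rw [hl2, h]
    · ring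
  have hB : s ^ 2 / e ^ 2 * frobSq (Matrix.of fun (i : Fin d0) (j : Fin d1) =>
      if (i : ℕ) = (j : ℕ) then θ j else 0) = ∑ i ∈ Finset.range N, s * ν i := by
    rw [← sum_rdiag d0 d1 N (by omega) (fun i => s * max 0 (ζ i - s)) (fun i => s * ν i)
      (fun i _ hi => by simp only [ν, if_pos hi])
      (fun i hi => by rw [hνz i (le_trans (min_le_left _ _) hi), mul_zero])
      (fun i hi => by rw [hνz1 i hi, mul_zero])]
    simp only [frobSq, Finset.mul_sum, Matrix.of_apply]
    refine Finset.sum_congr rfl fun i _ => Finset.sum_congr rfl fun j _ => ?_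
    split_ifs with h
    · rw [ht2, h]
    · ring
  have hprod : ∀ (i : Fin d2) (j : Fin d0),
      ((Matrix.of fun (i : Fin d2) (j : Fin d1) => if (i : ℕ) = (j : ℕ) then lam j else 0) *
      (Matrix.of fun (i : Fin d0) (j : Fin d1) => if (i : ℕ) = (j : ℕ) then θ j else 0)ᵀ) i j
      = if (i : ℕ) = (j : ℕ) then ν i else 0 := by
    intro i j
    simp only [Matrix.mul_apply, Matrix.transpose_apply, Matrix.of_apply]
    by_cases hi : (i : ℕ) < d1
    · rw [Finset.sum_eq_single (⟨i, hi⟩ : Fin d1)]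
      · simp only [if_true, ν, if_pos hi]
        by_cases hij : (i : ℕ) = j
        · rw [if_pos hij.symm, if_pos hij, hlt]
        · rw [if_neg (fun h => hij h.symm), if_neg hij, mul_zero]
      · intro b _ hb
        rw [if_neg, zero_mul]
        intro h
        exact hb (Fin.ext h.symm)
      · simp
    · rw [hνz1 i (by omega), ite_self]
      refine Finset.sum_eq_zero fun l _ => ?_
      rw [if_neg, zero_mul]
      have := l.2
      omega
  have hC : frobSq ((Matrix.of fun (i : Fin d2) (j : Fin d1) =>
        if (i : ℕ) = (j : ℕ) then lam j else 0) *
      (Matrix.of fun (i : Fin d0) (j : Fin d1) => if (i : ℕ) = (j : ℕ) then θ j else 0)ᵀ -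
      Matrix.of fun (i : Fin d2) (j : Fin d0) => if (i : ℕ) = (j : ℕ) then ζ i else 0)
      = ∑ i ∈ Finset.range N, (ν i - ζ i) ^ 2 := by
    rw [← sum_rdiag d2 d0 N (by omega) (fun i => (ν i - ζ i) ^ 2) (fun i => (ν i - ζ i) ^ 2)
      (fun _ _ _ => rfl)
      (fun i hi => by
        rw [hνz i (le_trans (min_le_right _ _) hi), hz i (le_trans (min_le_right _ _) hi)]; ring)
      (fun i hi => by
        rw [hνz i (le_trans (min_le_left _ _) hi), hz i (le_trans (min_le_left _ _) hi)]; ring)]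
    simp only [frobSq]
    refine Finset.sum_congr rfl fun i _ => Finset.sum_congr rfl fun j _ => ?_
    rw [Matrix.sub_apply, hprod, Matrix.of_apply]
    split_ifs <;> ring
  rw [hA, hB, hC, sum_range_ext d1 N (by omega) (fun i => (max 0 (ζ i - s)) ^ 2)
    (fun i => ν i ^ 2) (fun i hi => by simp only [ν, if_pos hi])
    (fun i hi => by rw [hνz1 i hi]; ring), ← Finset.sum_add_distrib, ← Finset.sum_add_distrib,
    ← Finset.sum_sub_distrib]
  refine Finset.sum_congr rfl fun i _ => ?_
  have : ν i * (ν i - (ζ i - s)) = 0 := by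
    simp only [ν]
    split_ifs
    · rcases max_cases 0 (ζ i - s) with ⟨h, h'⟩ | ⟨h, h'⟩ <;> rw [h] <;> ring
    · ring
  linarith [this]

/-- global minimizer of `L` when `σ_i = η_enc` for all `i`, and the
exact condition for complete posterior collapse (the origin being a global
minimizer): `ζ_1 ≤ √β · η_dec`. -/
theorem global_min_of_L_nonlearnable_sigma
    (d0 d1 d2 : ℕ) (hd0 : 1 ≤ d0) (hd1 : 1 ≤ d1) (hd2 : 1 ≤ d2)
    (β ηenc ηdec : ℝ) (hβ : 0 < β) (henc : 0 < ηenc) (hdec : 0 < ηdec)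
    (ζ : ℕ → ℝ) (hζmono : ∀ i j, i ≤ j → ζ j ≤ ζ i) (hζnn : ∀ i, 0 ≤ ζ i)
    (hζzero : ∀ i, min d0 d2 ≤ i → ζ i = 0)
    (F : Matrix (Fin d2) (Fin d2) ℝ) (G : Matrix (Fin d0) (Fin d0) ℝ)
    (hF : Fᵀ * F = 1) (hF' : F * Fᵀ = 1) (hG : Gᵀ * G = 1) (hG' : G * Gᵀ = 1)
    (Z : Matrix (Fin d2) (Fin d0) ℝ)
    (hZ : Z = F * (Matrix.of fun (i : Fin d2) (j : Fin d0) =>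
        if (i : ℕ) = (j : ℕ) then ζ i else 0) * Gᵀ)
    (L : Matrix (Fin d2) (Fin d1) ℝ → Matrix (Fin d0) (Fin d1) ℝ → ℝ)
    (hL : ∀ U V, L U V = frobSq (U * Vᵀ - Z)
        + Matrix.trace (U * Matrix.diagonal (fun _ : Fin d1 => ηenc ^ 2) * Uᵀ)
        + β * (ηdec ^ 2 / ηenc ^ 2) * frobSq V)
    (lam θ : Fin d1 → ℝ)
    (hlam : ∀ i, lam i = Real.sqrt (max 0
        ((Real.sqrt β * ηdec / ηenc ^ 2) * (ζ i - Real.sqrt β * ηdec))))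
    (hθ : ∀ i, θ i = Real.sqrt (max 0
        ((ηenc ^ 2 / (Real.sqrt β * ηdec)) * (ζ i - Real.sqrt β * ηdec))))
    (Λ : Matrix (Fin d2) (Fin d1) ℝ)
    (hΛ : Λ = Matrix.of fun (i : Fin d2) (j : Fin d1) =>
        if (i : ℕ) = (j : ℕ) then lam j else 0)
    (Θ : Matrix (Fin d0) (Fin d1) ℝ)
    (hΘ : Θ = Matrix.of fun (i : Fin d0) (j : Fin d1) =>
        if (i : ℕ) = (j : ℕ) then θ j else 0) :
    (∀ P : Matrix (Fin d1) (Fin d1) ℝ, Pᵀ * P = 1 → P * Pᵀ = 1 →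
        ∀ U V, L (F * Λ * P) (G * Θ * P) ≤ L U V)
    ∧ ((∀ U V, L 0 0 ≤ L U V) ↔ ζ 0 ≤ Real.sqrt β * ηdec) := by
  set s := Real.sqrt β * ηdec with hs_def
  have hs : 0 < s := mul_pos (Real.sqrt_pos.2 hβ) hdec
  have hs2 : β * (ηdec ^ 2 / ηenc ^ 2) = s ^ 2 / ηenc ^ 2 := by
    rw [hs_def, mul_pow, Real.sq_sqrt hβ.le, mul_div_assoc]
  set D : Matrix (Fin d2) (Fin d0) ℝ := Matrix.of fun (i : Fin d2) (j : Fin d0) =>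
        if (i : ℕ) = (j : ℕ) then ζ i else 0 with hD
  have hrot : ∀ (A : Matrix (Fin d2) (Fin d1) ℝ) (B : Matrix (Fin d0) (Fin d1) ℝ), L (F * A) (G * B) = frobSq (A * Bᵀ - D) + ηenc ^ 2 * frobSq A
      + s ^ 2 / ηenc ^ 2 * frobSq B := by
    intro A B
    rw [hL, trace_diag_eq, frobSq_mul_left F hF, frobSq_mul_left G hG, hs2, hZ]
    have : F * A * (G * B)ᵀ - F * D * Gᵀ = F * ((A * Bᵀ - D) * Gᵀ) := by
      rw [Matrix.transpose_mul, Matrix.sub_mul, Matrix.mul_sub]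
      simp only [Matrix.mul_assoc]
    rw [this, frobSq_mul_left F hF, frobSq_mul_right Gᵀ (by rw [Matrix.transpose_transpose, hG])]
  have hlow : ∀ U V, ∑ i ∈ Finset.range (d0 + d1 + d2), ζ i ^ 2
      - ∑ i ∈ Finset.range d1, (max 0 (ζ i - s)) ^ 2 ≤ L U V := by
    intro U V
    have h := hrot (Fᵀ * U) (Gᵀ * V)
    rw [← Matrix.mul_assoc, hF', Matrix.one_mul, ← Matrix.mul_assoc, hG', Matrix.one_mul] at h
    rw [h]
    exact lower_bound le_rfl henc hs ζ hζmono hζnn hζzero _ _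
  have hval : ∀ P : Matrix (Fin d1) (Fin d1) ℝ, P * Pᵀ = 1 →
      L (F * Λ * P) (G * Θ * P) = ∑ i ∈ Finset.range (d0 + d1 + d2), ζ i ^ 2
      - ∑ i ∈ Finset.range d1, (max 0 (ζ i - s)) ^ 2 := by
    intro P hP
    rw [Matrix.mul_assoc, Matrix.mul_assoc, hrot, frobSq_mul_right P hP, frobSq_mul_right P hP]
    have : Λ * P * (Θ * P)ᵀ = Λ * Θᵀ := by
      rw [Matrix.transpose_mul, Matrix.mul_assoc, ← Matrix.mul_assoc P, hP, Matrix.one_mul]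
    rw [this, hΛ, hΘ]
    exact value_at le_rfl henc hs ζ hζzero lam θ hlam hθ
  have h00 : L 0 0 = ∑ i ∈ Finset.range (d0 + d1 + d2), ζ i ^ 2 := by
    have h := hrot 0 0
    rw [Matrix.mul_zero, Matrix.mul_zero] at h
    rw [h, ← sum_rdiag d2 d0 (d0 + d1 + d2) (by omega) (fun i => ζ i ^ 2) (fun i => ζ i ^ 2)
      (fun _ _ _ => rfl)
      (fun i hi => by rw [hζzero i (le_trans (min_le_right _ _) hi)]; ring)
      (fun i hi => by rw [hζzero i (le_trans (min_le_left _ _) hi)]; ring)]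
    simp [frobSq, hD]
  refine ⟨fun P _ hP U V => by rw [hval P hP]; exact hlow U V, ?_, ?_⟩
  · intro hmin
    have h := hmin (F * Λ * (1 : Matrix (Fin d1) (Fin d1) ℝ)) (G * Θ * (1 : Matrix (Fin d1) (Fin d1) ℝ))
    rw [hval 1 (by simp), h00] at h
    have h1 : (max 0 (ζ 0 - s)) ^ 2 ≤ ∑ i ∈ Finset.range d1, (max 0 (ζ i - s)) ^ 2 :=
      Finset.single_le_sum (f := fun i => (max 0 (ζ i - s)) ^ 2)
        (fun i _ => by positivity) (Finset.mem_range.2 hd1)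
    by_contra hcon
    have h2 : 0 < max 0 (ζ 0 - s) := lt_max_of_lt_right (by linarith)
    have := pow_pos h2 2
    linarith
  · intro hle U V
    have h0 : ∑ i ∈ Finset.range d1, (max 0 (ζ i - s)) ^ 2 = 0 :=
      Finset.sum_eq_zero fun i _ => by
        rw [max_eq_left (by linarith [hζmono 0 i (Nat.zero_le i)])]; ring
    have := hlow U V
    rw [h00]
    linarith
end

section
/- If d2 ≠ β d̂_1, then G has at most one stationary point on (0, ∞), i.e. there is at most one s > 0 with G'(s) = 0. -/
open BigOperators

lemma F_hasDerivAt (β z s : ℝ) (hβ : 0 < β) (hz : 0 < z) (hs : 0 < s) :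
    HasDerivAt (fun s : ℝ => if s < z / β
        then z / s + β * (Real.log (β * s / z) - 1) else 0) (-(max (z - β * s) 0) / s ^ 2) s := by
  have h1 : HasDerivAt (fun s : ℝ => z / s + β * (Real.log (β * s / z) - 1))
      (-(z - β * s) / s ^ 2) s := by
    have ha : HasDerivAt (fun s : ℝ => β * s / z) (β / z) s := by
      simpa using ((hasDerivAt_id s).const_mul β).div_const z
    have hb := ((ha.log (by positivity)).sub_const 1).const_mul β
    have hc := (hasDerivAt_inv hs.ne').const_mul z
    have hd := hc.add hb
    refine (hd.congr_deriv ?_).congr_of_eventuallyEq ?_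
    · field_simp
      ring
    · refine Filter.Eventually.of_forall fun x => ?_
      simp [div_eq_mul_inv]
  rcases lt_trichotomy s (z / β) with h | h | h
  · have h2 : β * s < z := by rw [lt_div_iff₀ hβ] at h; linarith
    rw [max_eq_left (by linarith)]
    refine h1.congr_of_eventuallyEq ?_
    filter_upwards [Iio_mem_nhds h] with x hx
    exact if_pos hx
  · have h2 : β * s = z := by rw [h]; field_simp
    rw [max_eq_right (by linarith)]
    have e : -(z - β * s) / s ^ 2 = -0 / s ^ 2 := by rw [h2]; simp
    rw [e] at h1
    have f0 : z / s + β * (Real.log (β * s / z) - 1) = 0 := by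
      rw [h2, div_self hz.ne', Real.log_one, ← h2]; field_simp; ring
    have hl := (h1.hasDerivWithinAt (s := Set.Iic s))
    have hr : HasDerivWithinAt (fun _ : ℝ => (0:ℝ)) (-0 / s ^ 2) (Set.Ici s) s := by
      simpa using hasDerivWithinAt_const s (Set.Ici s) (0:ℝ)
    rw [← hasDerivWithinAt_univ, ← Set.Iic_union_Ici (a := s)]
    refine HasDerivWithinAt.union (hl.congr ?_ ?_) (hr.congr ?_ ?_)
    · intro x hx
      rcases lt_or_eq_of_le (Set.mem_Iic.1 hx) with hx | hx
      · exact if_pos (h ▸ hx)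
      · subst hx
        simp only [f0, ite_self]
    · simp only [f0, ite_self]
    · intro x hx
      exact if_neg (not_lt.2 (h ▸ (Set.mem_Ici.1 hx)))
    · simp only [f0, ite_self]
  · have h2 : z < β * s := by rw [div_lt_iff₀ hβ] at h; linarith
    rw [max_eq_right (by linarith)]
    have hr : HasDerivAt (fun _ : ℝ => (0:ℝ)) (-0 / s ^ 2) s := by
      simpa using hasDerivAt_const s (0:ℝ)
    refine hr.congr_of_eventuallyEq ?_
    filter_upwards [Ioi_mem_nhds h] with x hx
    exact if_neg (not_lt.2 (le_of_lt hx))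

lemma m_convex (β z s t : ℝ) (hβ : 0 < β) (hz : 0 < z) (hs : 0 < s) (hst : s < t) :
    t * max (z - β * s) 0 ≤ (t - s) * z + s * max (z - β * t) 0 := by
  have h1 : 0 ≤ s * max (z - β * t) 0 := mul_nonneg hs.le (le_max_right _ _)
  have h2 : s * (z - β * t) ≤ s * max (z - β * t) 0 :=
    mul_le_mul_of_nonneg_left (le_max_left _ _) hs.le
  have h3 : 0 < (t - s) * z := mul_pos (by linarith) hz
  rcases max_cases (z - β * s) 0 with ⟨h, _⟩ | ⟨h, _⟩ <;> rw [h] <;> nlinarith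

lemma m_strict (β z s t : ℝ) (hz : 0 < z) (hs : 0 < s) (hst : s < t)
    (h : t * max (z - β * s) 0 = (t - s) * z + s * max (z - β * t) 0) :
    max (z - β * t) 0 = z - β * t := by
  rcases max_cases (z - β * t) 0 with ⟨h1, _⟩ | ⟨h1, h2⟩
  · exact h1
  · exfalso
    rw [h1] at h
    have h3 : 0 < (t - s) * z := mul_pos (by linarith) hz
    rcases max_cases (z - β * s) 0 with ⟨h4, _⟩ | ⟨h4, _⟩ <;> rw [h4] at h <;> nlinarith

/-- if `d2 ≠ β d̂₁` then `G` has at most one stationary point on `(0,∞)`. -/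
theorem G_at_most_one_stationary
    (β : ℝ) (hβ : 0 < β) (d2 : ℕ) (hd2 : 1 ≤ d2)
    (d1h dsh : ℕ) (hd1h : 1 ≤ d1h) (hd1s : d1h ≤ dsh)
    (ζ : ℕ → ℝ) (hζpos : ∀ i < dsh, 0 < ζ i)
    (hζmono : ∀ i j, i ≤ j → j < dsh → ζ j ≤ ζ i)
    (Ffun : ℕ → ℝ → ℝ)
    (hFfun : ∀ i (s : ℝ), Ffun i s = if s < ζ i ^ 2 / β
        then ζ i ^ 2 / s + β * (Real.log (β * s / ζ i ^ 2) - 1) else 0)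
    (G : ℝ → ℝ)
    (hG : ∀ s : ℝ, G s = (1 / (2 * s)) * ∑ i ∈ Finset.range dsh, ζ i ^ 2
        - (1 / 2) * ∑ i ∈ Finset.range d1h, Ffun i s
        + ((d2 : ℝ) / 2) * Real.log s)
    :
    (d2 : ℝ) ≠ β * (d1h : ℝ) →
      ∀ s t : ℝ, 0 < s → 0 < t → deriv G s = 0 → deriv G t = 0 → s = t := by
  
  intro hne
  have key : ∀ s : ℝ, 0 < s → deriv G s = 0 →
      -(∑ i ∈ Finset.range dsh, ζ i ^ 2)
        + ∑ i ∈ Finset.range d1h, max (ζ i ^ 2 - β * s) 0 + d2 * s = 0 := by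
    intro s hs h0
    have hF : ∀ i ∈ Finset.range d1h,
        HasDerivAt (Ffun i) (-(max (ζ i ^ 2 - β * s) 0) / s ^ 2) s := by
      intro i hi
      have hi' : 0 < ζ i := hζpos i (lt_of_lt_of_le (Finset.mem_range.1 hi) hd1s)
      have e : Ffun i = _ := funext (hFfun i)
      rw [e]
      exact F_hasDerivAt β (ζ i ^ 2) s hβ (by positivity) hs
    have hsum := (HasDerivAt.fun_sum hF).const_mul (1 / 2 : ℝ)
    have hlog := (Real.hasDerivAt_log hs.ne').const_mul ((d2 : ℝ) / 2)
    have hinv := (hasDerivAt_inv hs.ne').const_mul ((∑ i ∈ Finset.range dsh, ζ i ^ 2) / 2)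
    have hall := (hinv.sub hsum).add hlog
    have hGd := hall.congr_of_eventuallyEq (f₁ := G) (Filter.Eventually.of_forall fun x => by
      rw [hG]
      simp only [Pi.add_apply, Pi.sub_apply]
      rw [one_div, mul_inv]
      ring)
    rw [hGd.deriv, ← Finset.sum_div, Finset.sum_neg_distrib] at h0
    generalize ∑ i ∈ Finset.range d1h, max (ζ i ^ 2 - β * s) 0 = P at *
    field_simp at h0
    linarith
  have main : ∀ s t : ℝ, 0 < s → s < t → deriv G s = 0 → deriv G t = 0 → False := by
    intro s t hs hst h1 h2
    have ks := key s hs h1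
    have kt := key t (hs.trans hst) h2
    have hz : ∀ i ∈ Finset.range d1h, 0 < ζ i ^ 2 := fun i hi =>
      pow_pos (hζpos i (lt_of_lt_of_le (Finset.mem_range.1 hi) hd1s)) 2
    have hS : ∑ i ∈ Finset.range d1h, ζ i ^ 2 ≤ ∑ i ∈ Finset.range dsh, ζ i ^ 2 :=
      Finset.sum_le_sum_of_subset_of_nonneg (Finset.range_mono hd1s)
        (fun i _ _ => sq_nonneg _)
    have hle : ∀ i ∈ Finset.range d1h, t * max (ζ i ^ 2 - β * s) 0
        ≤ (t - s) * ζ i ^ 2 + s * max (ζ i ^ 2 - β * t) 0 := fun i hi =>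
      m_convex β _ s t hβ (hz i hi) hs hst
    have hsl := Finset.sum_le_sum hle
    have eL : ∑ i ∈ Finset.range d1h, t * max (ζ i ^ 2 - β * s) 0
        = t * ∑ i ∈ Finset.range d1h, max (ζ i ^ 2 - β * s) 0 := by rw [Finset.mul_sum]
    have eR : ∑ i ∈ Finset.range d1h, ((t - s) * ζ i ^ 2 + s * max (ζ i ^ 2 - β * t) 0)
        = (t - s) * ∑ i ∈ Finset.range d1h, ζ i ^ 2
          + s * ∑ i ∈ Finset.range d1h, max (ζ i ^ 2 - β * t) 0 := by
      rw [Finset.sum_add_distrib, Finset.mul_sum, Finset.mul_sum]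
    have hsl' := hsl
    rw [eL, eR] at hsl'
    generalize hA : ∑ i ∈ Finset.range d1h, ζ i ^ 2 = A at *
    generalize ∑ i ∈ Finset.range dsh, ζ i ^ 2 = S at *
    generalize ∑ i ∈ Finset.range d1h, max (ζ i ^ 2 - β * s) 0 = P at *
    generalize hQ : ∑ i ∈ Finset.range d1h, max (ζ i ^ 2 - β * t) 0 = Q at *
    have hP : P = S - d2 * s := by linarith
    have hQ' : Q = S - d2 * t := by linarith
    have hge : (t - s) * S ≤ (t - s) * A := by rw [hP, hQ'] at hsl'; linarith
    have hSA : S = A := le_antisymm (le_of_mul_le_mul_left hge (by linarith)) hS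
    have heq : t * P = (t - s) * A + s * Q := by rw [hP, hQ', hSA]; ring
    have hterm := (Finset.sum_eq_sum_iff_of_le hle).1 (by rw [eL, eR, heq])
    have hQ2 : Q = A - d1h * (β * t) := by
      rw [← hQ, ← hA, Finset.sum_congr rfl fun i hi =>
        m_strict β _ s t (hz i hi) hs hst (hterm i hi)]
      simp [Finset.sum_sub_distrib]
    apply hne
    have : ((d2 : ℝ) - β * d1h) * t = 0 := by rw [hQ', hSA] at hQ2; linarith
    rcases mul_eq_zero.1 this with h | h <;> linarith
  intro s t hs ht h1 h2
  rcases lt_trichotomy s t with h | h | h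
  · exact (main s t hs h h1 h2).elim
  · exact h
  · exact (main t s ht h h2 h1).elim
end
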